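/- Fix a constant c > 0. There is a constant ε > 0 such that for every sufficiently large n and every c-Ramsey graph G on n vertices, every treelike resolution refutation of the unary CNF formula Ψ'_G has length at least n^{ε·log₂ n}. -/

import Mathlib

open Classical
noncomputable section

/-- A clause: a finite set of literals, where a literal is a pair (variable, polarity). -/
abbrev Clause (V : Type) := Finset (V × Bool)

/-- A literal `(x, b)` is satisfied by assignment `a` iff `a x = b`. -/
def litSat {V : Type} (a : V → Bool) (l : V × Bool) : Prop := a l.1 = l.2

/-- A clause is satisfied if some literal in it is satisfied. -/
def clauseSat {V : Type} (a : V → Bool) (C : Clause V) : Prop := ∃ l ∈ C, litSat a l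

/-- A CNF formula: a set of clauses. -/
abbrev CNF (V : Type) := Set (Clause V)

/-- A CNF is satisfiable if some assignment satisfies all its clauses. -/
def Satisfiable {V : Type} (φ : CNF V) : Prop := ∃ a : V → Bool, ∀ C ∈ φ, clauseSat a C

/-- A resolution refutation of a CNF `φ`: a sequence of clauses, each either a clause of `φ`
or obtained from two earlier clauses `A ∨ x`, `B ∨ ¬x` by the resolution rule (yielding
`A ∨ B`), ending with the empty clause. -/
structure Refutation {V : Type} [DecidableEq V] (φ : CNF V) where
  clauses : List (Clause V)
  nonempty : clauses ≠ []
  valid : ∀ i : Fin clauses.length, clauses.get i ∈ φ ∨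
    ∃ j k : Fin clauses.length, j < i ∧ k < i ∧
      ∃ (x : V) (A B : Clause V),
        clauses.get j = insert (x, true) A ∧
        clauses.get k = insert (x, false) B ∧
        clauses.get i = A ∪ B
  last_empty : clauses.getLast nonempty = ∅

/-- The length of a refutation: the number of clauses in the sequence. -/
def Refutation.length {V : Type} [DecidableEq V] {φ : CNF V} (R : Refutation φ) : ℕ :=
  R.clauses.length

/-- The width of a refutation: the maximum width (number of literals) of a clause in it. -/
def Refutation.width {V : Type} [DecidableEq V] {φ : CNF V} (R : Refutation φ) : ℕ :=
  (R.clauses.map Finset.card).foldr max 0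

/-- `L(φ)`: minimum length of a resolution refutation of `φ` (`⊤` if none exists,
in particular if `φ` is satisfiable). -/
def resLength {V : Type} [DecidableEq V] (φ : CNF V) : ℕ∞ :=
  sInf {l : ℕ∞ | ∃ R : Refutation φ, (R.length : ℕ∞) = l}

/-- `W(φ)`: minimum over refutations of the maximum clause width. -/
def resWidth {V : Type} [DecidableEq V] (φ : CNF V) : ℕ :=
  sInf {w : ℕ | ∃ R : Refutation φ, R.width = w}

/-- Treelike resolution derivations of a clause from the clauses of `φ`. -/
inductive ResTree {V : Type} [DecidableEq V] (φ : CNF V) : Clause V → Type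
  | ax (C : Clause V) (h : C ∈ φ) : ResTree φ C
  | res (x : V) (A B : Clause V) :
      ResTree φ (insert (x, true) A) → ResTree φ (insert (x, false) B) → ResTree φ (A ∪ B)

/-- The length (number of clauses, i.e. nodes) of a treelike derivation. -/
def ResTree.size {V : Type} [DecidableEq V] {φ : CNF V} {C : Clause V} : ResTree φ C → ℕ
  | .ax _ _ => 1
  | .res _ _ _ t₁ t₂ => t₁.size + t₂.size + 1

/-! ### The Prover–Adversary game -/

/-- A Prover move: query a variable, or erase (forget) a stored value. -/
inductive PMove (V : Type)
  | query (x : V)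
  | forget (x : V)

/-- A history of the game: list of moves (most recent first) together with the
Adversary's answer for query moves. -/
abbrev History (V : Type) := List (PMove V × Option Bool)

/-- A Prover strategy: choose the next move given the history so far. -/
def ProverStrat (V : Type) := History V → PMove V

/-- An Adversary strategy: answer a queried variable, given the history so far. -/
def AdvStrat (V : Type) := History V → V → Bool

/-- The stored partial assignment (memory content) determined by a history. -/
def memOf {V : Type} [DecidableEq V] : History V → V → Option Bool
  | [] => fun _ => none
  | (PMove.query x, ans) :: h => Function.update (memOf h) x ans
  | (PMove.forget x, _) :: h => Function.update (memOf h) x none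

/-- The history after `t` rounds of play between strategies `P` and `A`. -/
def play {V : Type} (P : ProverStrat V) (A : AdvStrat V) : ℕ → History V
  | 0 => []
  | t + 1 =>
    let h := play P A t
    match P h with
    | PMove.query x => (PMove.query x, some (A h x)) :: h
    | PMove.forget x => (PMove.forget x, none) :: h

/-- Number of memory locations in use: number of variables with a stored value. -/
def memSize {V : Type} [Fintype V] [DecidableEq V] (h : History V) : ℕ :=
  (Finset.univ.filter fun x => (memOf h x).isSome).card

/-- The stored partial assignment falsifies clause `C`: every literal of `C` is
assigned and falsified. -/
def falsifies {V : Type} [DecidableEq V] (h : History V) (C : Clause V) : Prop :=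
  ∀ l ∈ C, memOf h l.1 = some (!l.2)

/-- The Prover has a strategy winning the game on `φ` while never storing more than `M`
values: against every Adversary, the memory stays within `M` and at some point the
stored partial assignment falsifies a clause of `φ`. -/
def ProverWinsWith {V : Type} [Fintype V] [DecidableEq V] (φ : CNF V) (M : ℝ) : Prop :=
  ∃ P : ProverStrat V, ∀ A : AdvStrat V,
    (∀ t, (memSize (play P A t) : ℝ) ≤ M) ∧ ∃ t, ∃ C ∈ φ, falsifies (play P A t) C

/-- The Adversary has a strategy winning against every Prover who uses at most `M`
memory locations: whenever the play keeps the memory within `M`, no clause of `φ` is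
ever falsified. -/
def AdversaryWinsAgainst {V : Type} [Fintype V] [DecidableEq V] (φ : CNF V) (M : ℝ) : Prop :=
  ∃ A : AdvStrat V, ∀ P : ProverStrat V,
    (∀ t, (memSize (play P A t) : ℝ) ≤ M) → ∀ t, ∀ C ∈ φ, ¬ falsifies (play P A t) C

/-! ### Ramsey graphs and the formulas `Ψ_G`, `Clique(G)` -/

/-- A graph on `n` vertices is `c`-Ramsey if no set of `c·log₂ n` vertices forms a clique
or an independent set. -/
def IsCRamsey (c : ℝ) {n : ℕ} (G : SimpleGraph (Fin n)) : Prop :=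
  ¬ ∃ T : Finset (Fin n), T.card = ⌈c * Real.logb 2 n⌉₊ ∧
      (G.IsClique (T : Set (Fin n)) ∨ Gᶜ.IsClique (T : Set (Fin n)))

/-- The number `ck` of indices. -/
def numIdx (c : ℝ) (k : ℕ) : ℕ := ⌈c * (k : ℕ)⌉₊

/-- Variables of the formula `Clique(G)`: bit `b` of the vertex assigned to index `i`. -/
abbrev CliqueVar (c : ℝ) (k : ℕ) := Fin (numIdx c k) × Fin k

/-- Variables of `Ψ_G`: the bit variables `x^i_b` together with the extra variable `y`. -/
abbrev PsiVar (c : ℝ) (k : ℕ) := CliqueVar c k ⊕ Unit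

/-- Bit `b` of the binary representation of vertex `v`. -/
def vbit {k : ℕ} (v : Fin (2 ^ k)) (b : Fin k) : Bool := Nat.testBit v.val b.val

/-- The clause `⋁_b (x^i_b ≠ v_b)`, saying that index `i` is not mapped to vertex `v`. -/
def neqClause (c : ℝ) (k : ℕ) (i : Fin (numIdx c k)) (v : Fin (2 ^ k)) :
    Clause (CliqueVar c k) :=
  Finset.univ.image fun b : Fin k => (((i, b) : CliqueVar c k), ! vbit v b)

/-- The CNF `Clique(G)`: injectivity clauses, plus for each non-edge `{u,v}` and distinct
indices `i,j` the clause `⋁_b (x^i_b ≠ u_b) ∨ ⋁_b (x^j_b ≠ v_b)`.  It is satisfiable iff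
`G` has a clique of size `ck`. -/
def CliqueCNF (c : ℝ) {k : ℕ} (G : SimpleGraph (Fin (2 ^ k))) : CNF (CliqueVar c k) :=
  {C | (∃ i j : Fin (numIdx c k), i ≠ j ∧ ∃ v : Fin (2 ^ k),
          C = neqClause c k i v ∪ neqClause c k j v) ∨
       (∃ i j : Fin (numIdx c k), i ≠ j ∧ ∃ u v : Fin (2 ^ k), u ≠ v ∧ ¬ G.Adj u v ∧
          C = neqClause c k i u ∪ neqClause c k j v)}

/-- Lift a clause on the bit variables to the variable set of `Ψ_G`. -/
def liftClause {c : ℝ} {k : ℕ} (C : Clause (CliqueVar c k)) : Clause (PsiVar c k) :=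
  C.image fun l => (Sum.inl l.1, l.2)

/-- The CNF `Ψ_G`: (1) injectivity clauses; (2) for each edge `{u,v}` and distinct `i,j`
the clause `y ∨ ⋁_b (x^i_b ≠ u_b) ∨ ⋁_b (x^j_b ≠ v_b)`; (3) for each non-edge `{u,v}` and
distinct `i,j` the clause `¬y ∨ ⋁_b (x^i_b ≠ u_b) ∨ ⋁_b (x^j_b ≠ v_b)`. -/
def PsiCNF (c : ℝ) {k : ℕ} (G : SimpleGraph (Fin (2 ^ k))) : CNF (PsiVar c k) :=
  {C | (∃ i j : Fin (numIdx c k), i ≠ j ∧ ∃ v : Fin (2 ^ k),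
          C = liftClause (neqClause c k i v ∪ neqClause c k j v)) ∨
       (∃ i j : Fin (numIdx c k), i ≠ j ∧ ∃ u v : Fin (2 ^ k), G.Adj u v ∧
          C = insert (Sum.inr (), true)
                (liftClause (neqClause c k i u ∪ neqClause c k j v))) ∨
       (∃ i j : Fin (numIdx c k), i ≠ j ∧ ∃ u v : Fin (2 ^ k), u ≠ v ∧ ¬ G.Adj u v ∧
          C = insert (Sum.inr (), false)
                (liftClause (neqClause c k i u ∪ neqClause c k j v)))}

/-! ### Property P, density, probability -/

/-- Property P: for every `U ⊆ V(G)` with `|U| ≤ k/3` and every pattern `p` with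
`|p| ≤ k/3`, some common neighbour of `U` is consistent with `p`.  A pattern is a partial
assignment `p : Fin k → Option Bool` of the `k` bits; its size is the number of assigned
bits. -/
def PropertyP {k : ℕ} (G : SimpleGraph (Fin (2 ^ k))) : Prop :=
  ∀ U : Finset (Fin (2 ^ k)), 3 * U.card ≤ k →
    ∀ p : Fin k → Option Bool, 3 * (Finset.univ.filter fun b => (p b).isSome).card ≤ k →
      ∃ v : Fin (2 ^ k), (∀ u ∈ U, G.Adj u v) ∧
        ∀ (b : Fin k) (bit : Bool), p b = some bit → vbit v b = bit

/-- The mutual density `d(A,B) = e(A,B)/(|A|·|B|)`, where `e(A,B)` is the number of pairs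
`(a,b) ∈ A × B` with `{a,b}` an edge. -/
def density {α : Type} (G : SimpleGraph α) (A B : Finset α) : ℝ :=
  (((A ×ˢ B).filter fun ab => G.Adj ab.1 ab.2).card : ℝ) / ((A.card : ℝ) * (B.card : ℝ))

/-- The probability of the event `P` under the uniform distribution on a finite type;
the uniform distribution on `SimpleGraph (Fin n)` is exactly `G(n, 1/2)`. -/
def probOf {α : Type} [Fintype α] (P : α → Prop) : ℝ :=
  ((Finset.univ.filter P).card : ℝ) / (Fintype.card α : ℝ)

/-! ### The unary formula `Ψ'_G` -/

/-- Variables of the unary formula `Ψ'_G`: variables `p^i_v` for `i ∈ [c·log₂ n]`,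
`v ∈ V(G)`, plus the extra variable `y`. -/
abbrev UnaryVar (c : ℝ) (n : ℕ) := (Fin ⌈c * Real.logb 2 n⌉₊ × Fin n) ⊕ Unit

/-- The unary CNF `Ψ'_G`: each index is mapped to exactly one vertex, the map is
injective, and (depending on `y`) the image is a clique or an independent set. -/
def PsiUnary (c : ℝ) {n : ℕ} (G : SimpleGraph (Fin n)) : CNF (UnaryVar c n) :=
  {C | (∃ i : Fin ⌈c * Real.logb 2 n⌉₊,
          C = Finset.univ.image fun v : Fin n => ((Sum.inl (i, v) : UnaryVar c n), true)) ∨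
       (∃ i : Fin ⌈c * Real.logb 2 n⌉₊, ∃ u v : Fin n, u ≠ v ∧
          C = {((Sum.inl (i, u) : UnaryVar c n), false), (Sum.inl (i, v), false)}) ∨
       (∃ i j : Fin ⌈c * Real.logb 2 n⌉₊, i ≠ j ∧ ∃ v : Fin n,
          C = {((Sum.inl (i, v) : UnaryVar c n), false), (Sum.inl (j, v), false)}) ∨
       (∃ i j : Fin ⌈c * Real.logb 2 n⌉₊, i ≠ j ∧ ∃ u v : Fin n, G.Adj u v ∧
          C = {((Sum.inr () : UnaryVar c n), true), (Sum.inl (i, u), false),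
               (Sum.inl (j, v), false)}) ∨
       (∃ i j : Fin ⌈c * Real.logb 2 n⌉₊, i ≠ j ∧ ∃ u v : Fin n, u ≠ v ∧ ¬ G.Adj u v ∧
          C = {((Sum.inr () : UnaryVar c n), false), (Sum.inl (i, u), false),
               (Sum.inl (j, v), false)})}

end

/-- `Good G M d W`: a hereditary extension property used by the adversary. -/
def GoodSet {n : ℕ} (G : SimpleGraph (Fin n)) (M : ℕ) : ℕ → Finset (Fin n) → Prop
  | 0, _ => True
  | d + 1, W => M ≤ W.card ∧ ∀ w ∈ W, ∃ W' : Finset (Fin n), W' ⊆ W ∧ (∀ x ∈ W', G.Adj w x) ∧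
      GoodSet G M d W'

/-- Adversary invariant. -/
structure AdvInv {c : ℝ} {n : ℕ} (G : SimpleGraph (Fin n)) (C : Clause (UnaryVar c n))
    (P Z : Finset (Fin ⌈c * Real.logb 2 n⌉₊ × Fin n)) (W : Finset (Fin n)) : Prop where
  func : ∀ i u v, (i, u) ∈ P → (i, v) ∈ P → u = v
  cliq : ∀ i j u v, i ≠ j → (i, u) ∈ P → (j, v) ∈ P → G.Adj u v
  ext : ∀ i u, (i, u) ∈ P → ∀ w ∈ W, G.Adj u w
  noy : ((Sum.inr () : UnaryVar c n), true) ∉ C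
  neg : ∀ i v, ((Sum.inl (i, v) : UnaryVar c n), false) ∈ C → (i, v) ∈ P
  pos : ∀ i v, ((Sum.inl (i, v) : UnaryVar c n), true) ∈ C →
    (i, v) ∉ P ∧ (v ∉ W ∨ (∃ u, (i, u) ∈ P) ∨ (i, v) ∈ Z)

theorem AdvInv.leaf {c : ℝ} {n : ℕ} {G : SimpleGraph (Fin n)} {C : Clause (UnaryVar c n)}
    {P Z : Finset (Fin ⌈c * Real.logb 2 n⌉₊ × Fin n)} {W : Finset (Fin n)}
    (h : AdvInv G C P Z W) (hC : C ∈ PsiUnary c G) (hZ : Z.card < W.card) : False := by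
  rcases hC with ⟨i, rfl⟩ | ⟨i, u, v, huv, rfl⟩ | ⟨i, j, hij, v, rfl⟩ | ⟨i, j, hij, u, v, huv, rfl⟩ |
    ⟨i, j, hij, u, v, huv, hadj, rfl⟩
  · have hp : ∀ v, (i, v) ∉ P ∧ (v ∉ W ∨ (∃ u, (i, u) ∈ P) ∨ (i, v) ∈ Z) := by
      intro v
      apply h.pos
      simp
    have hno : ¬ ∃ u, (i, u) ∈ P := by
      rintro ⟨u, hu⟩
      exact (hp u).1 hu
    have : W.card ≤ Z.card := by
      apply Finset.card_le_card_of_injOn (fun v => (i, v))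
      · intro v hv
        rcases (hp v).2 with h1 | h1 | h1
        · exact absurd hv h1
        · exact absurd h1 hno
        · exact h1
      · intro a _ b _ hab
        simpa using hab
    omega
  · exact huv (h.func i u v (h.neg _ _ (by simp)) (h.neg _ _ (by simp)))
  · exact G.irrefl (h.cliq i j v v hij (h.neg _ _ (by simp)) (h.neg _ _ (by simp)))
  · exact h.noy (by simp)
  · exact hadj (h.cliq i j u v hij (h.neg _ _ (by simp)) (h.neg _ _ (by simp)))

theorem tree_bound {c : ℝ} {n : ℕ} (G : SimpleGraph (Fin n)) (M : ℕ) {C : Clause (UnaryVar c n)}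
    (t : ResTree (PsiUnary c G) C) :
    ∀ (d z : ℕ) (P Z : Finset (Fin ⌈c * Real.logb 2 n⌉₊ × Fin n)) (W : Finset (Fin n)),
      GoodSet G M d W → Z.card + z ≤ M → AdvInv G C P Z W → (d + z).choose d ≤ t.size := by
  have one_le : ∀ {C : Clause (UnaryVar c n)} (t : ResTree (PsiUnary c G) C), 1 ≤ t.size := by
    intro C t
    cases t <;> simp [ResTree.size]
  induction t with
  | ax C hC =>
    intro d z P Z W hW hz hI
    rcases d with _ | d
    · simp [ResTree.size]
    rcases z with _ | z
    · simp [ResTree.size]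
    exact (hI.leaf hC (by have := hW.1; omega)).elim
  | res x A B t₁ t₂ ih₁ ih₂ =>
    intro d z P Z W hW hz hI
    rcases x with ⟨i, v⟩ | ⟨⟩
    · by_cases hP : (i, v) ∈ P
      · have := ih₂ d z P Z W hW hz ⟨hI.func, hI.cliq, hI.ext, ?_, ?_, ?_⟩
        · simp only [ResTree.size]; omega
        · intro h; apply hI.noy; simpa using Or.inr h
        · intro j w h
          simp only [Finset.mem_insert, Prod.mk.injEq, Sum.inl.injEq] at h
          rcases h with ⟨⟨rfl, rfl⟩, -⟩ | h
          · exact hP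
          · exact hI.neg _ _ (Finset.mem_union_right _ h)
        · intro j w h
          simp only [Finset.mem_insert, Prod.mk.injEq] at h
          rcases h with ⟨_, h⟩ | h
          · cases h
          · exact hI.pos _ _ (Finset.mem_union_right _ h)
      by_cases hF : v ∉ W ∨ (∃ u, (i, u) ∈ P) ∨ (i, v) ∈ Z
      · have := ih₁ d z P Z W hW hz ⟨hI.func, hI.cliq, hI.ext, ?_, ?_, ?_⟩
        · simp only [ResTree.size]; omega
        · intro h; apply hI.noy; exact Finset.mem_union_left _ (by simpa using h)
        · intro j w h
          simp only [Finset.mem_insert, Prod.mk.injEq] at h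
          rcases h with ⟨_, h⟩ | h
          · cases h
          · exact hI.neg _ _ (Finset.mem_union_left _ h)
        · intro j w h
          simp only [Finset.mem_insert, Prod.mk.injEq, Sum.inl.injEq] at h
          rcases h with ⟨⟨rfl, rfl⟩, -⟩ | h
          · exact ⟨hP, hF⟩
          · exact hI.pos _ _ (Finset.mem_union_left _ h)
      push Not at hF
      obtain ⟨hvW, hno, hvZ⟩ := hF
      rcases d with _ | d
      · simp [ResTree.size]
      rcases z with _ | z
      · simp [ResTree.size]
      obtain ⟨hMW, hext⟩ := hW
      obtain ⟨W', hW'W, hadj, hgood⟩ := hext v hvW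
      have e : (d + 1 + (z + 1)).choose (d + 1) =
          (d + (z + 1)).choose d + (d + 1 + z).choose (d + 1) := by
        rw [show d + 1 + (z + 1) = (d + (z + 1)) + 1 by ring, Nat.choose_succ_succ',
          show d + (z + 1) = d + 1 + z by ring]
      have h1 := ih₁ (d + 1) z P (insert (i, v) Z) W ⟨hMW, hext⟩
        (by have := Finset.card_insert_le (i, v) Z; omega)
        ⟨hI.func, hI.cliq, hI.ext, ?_, ?_, ?_⟩
      · have h2 := ih₂ d (z + 1) (insert (i, v) P) Z W' hgood hz ⟨?_, ?_, ?_, ?_, ?_, ?_⟩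
        · simp only [ResTree.size]; omega
        · intro j a b ha hb
          simp only [Finset.mem_insert, Prod.mk.injEq] at ha hb
          rcases ha with ⟨rfl, rfl⟩ | ha <;> rcases hb with ⟨hj, rfl⟩ | hb
          · rfl
          · exact (hno _ hb).elim
          · subst hj; exact (hno _ ha).elim
          · exact hI.func _ _ _ ha hb
        · intro j j' a b hjj ha hb
          simp only [Finset.mem_insert, Prod.mk.injEq] at ha hb
          rcases ha with ⟨rfl, rfl⟩ | ha <;> rcases hb with ⟨hj, rfl⟩ | hb
          · exact (hjj hj.symm).elim
          · exact (hI.ext _ _ hb _ hvW).symm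
          · exact hI.ext _ _ ha _ hvW
          · exact hI.cliq _ _ _ _ hjj ha hb
        · intro j a ha w hw
          simp only [Finset.mem_insert, Prod.mk.injEq] at ha
          rcases ha with ⟨rfl, rfl⟩ | ha
          · exact hadj w hw
          · exact hI.ext _ _ ha _ (hW'W hw)
        · intro h; apply hI.noy; simpa using Or.inr h
        · intro j w h
          simp only [Finset.mem_insert, Prod.mk.injEq, Sum.inl.injEq] at h ⊢
          rcases h with ⟨h, -⟩ | h
          · exact Or.inl h
          · exact Or.inr (hI.neg _ _ (Finset.mem_union_right _ h))
        · intro j w h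
          simp only [Finset.mem_insert, Prod.mk.injEq] at h
          rcases h with ⟨_, h⟩ | h
          · cases h
          · obtain ⟨h1, h2⟩ := hI.pos _ _ (Finset.mem_union_right _ h)
            refine ⟨?_, ?_⟩
            · simp only [Finset.mem_insert, Prod.mk.injEq, not_or]
              refine ⟨?_, h1⟩
              rintro ⟨rfl, rfl⟩
              rcases h2 with h2 | ⟨u, h2⟩ | h2
              · exact h2 hvW
              · exact hno _ h2
              · exact hvZ h2
            · rcases h2 with h2 | ⟨u, h2⟩ | h2
              · exact Or.inl fun h' => h2 (hW'W h')
              · exact Or.inr (Or.inl ⟨u, Finset.mem_insert_of_mem h2⟩)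
              · exact Or.inr (Or.inr h2)
      · intro h; apply hI.noy; exact Finset.mem_union_left _ (by simpa using h)
      · intro j w h
        simp only [Finset.mem_insert, Prod.mk.injEq] at h
        rcases h with ⟨_, h⟩ | h
        · cases h
        · exact hI.neg _ _ (Finset.mem_union_left _ h)
      · intro j w h
        simp only [Finset.mem_insert, Prod.mk.injEq, Sum.inl.injEq] at h
        rcases h with ⟨⟨rfl, rfl⟩, -⟩ | h
        · exact ⟨hP, Or.inr (Or.inr (Finset.mem_insert_self _ _))⟩
        · obtain ⟨h1, h2⟩ := hI.pos _ _ (Finset.mem_union_left _ h)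
          refine ⟨h1, ?_⟩
          rcases h2 with h2 | h2 | h2
          · exact Or.inl h2
          · exact Or.inr (Or.inl h2)
          · exact Or.inr (Or.inr (Finset.mem_insert_of_mem h2))
    · have := ih₂ d z P Z W hW hz ⟨hI.func, hI.cliq, hI.ext, ?_, ?_, ?_⟩
      · simp only [ResTree.size]; omega
      · intro h; apply hI.noy; simpa using Or.inr h
      · intro j w h
        simp only [Finset.mem_insert, Prod.mk.injEq] at h
        rcases h with ⟨h, -⟩ | h
        · cases h
        · exact hI.neg _ _ (Finset.mem_union_right _ h)
      · intro j w h
        simp only [Finset.mem_insert, Prod.mk.injEq] at h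
        rcases h with ⟨h, -⟩ | h
        · cases h
        · exact hI.pos _ _ (Finset.mem_union_right _ h)

/-- If no subset of `S` is `d`-good, then `S` contains a large independent set. -/
theorem indep_of_not_good {n : ℕ} (G : SimpleGraph (Fin n)) (M g : ℕ) (hg : 2 ≤ g) (hgM : g ≤ M) :
    ∀ (t d : ℕ) (S : Finset (Fin n)), (M : ℝ) ≤ S.card * ((1 / g : ℝ) ^ d * (1 - 2 / g : ℝ) ^ t) →
      (¬ ∃ W ⊆ S, GoodSet G M d W) →
      ∃ T : Finset (Fin n), T ⊆ S ∧ T.card = t ∧ Gᶜ.IsClique (T : Set (Fin n)) := by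
  have hg0 : (2 : ℝ) ≤ g := by exact_mod_cast hg
  have hb0 : (0 : ℝ) ≤ 1 - 2 / g := by
    rw [sub_nonneg, div_le_one (by linarith)]; exact hg0
  have hb1 : (1 - 2 / g : ℝ) ≤ 1 := by
    have : (0 : ℝ) ≤ 2 / g := by positivity
    linarith
  have ha0 : (0 : ℝ) ≤ 1 / g := by positivity
  have ha1 : (1 / g : ℝ) ≤ 1 := by
    rw [div_le_one (by linarith)]; linarith
  intro t
  induction t with
  | zero => intro d S _ _; exact ⟨∅, by simp, by simp, by simp⟩
  | succ t iht =>
    intro d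
    induction d with
    | zero => intro S _ h; exact (h ⟨∅, by simp, trivial⟩).elim
    | succ d ihd =>
      intro S hS hno
      have hMS : (M : ℝ) ≤ S.card := by
        refine hS.trans (mul_le_of_le_one_right (by positivity) ?_)
        exact mul_le_one₀ (pow_le_one₀ ha0 ha1) (pow_nonneg hb0 _) (pow_le_one₀ hb0 hb1)
      have hMS' : M ≤ S.card := by exact_mod_cast hMS
      have hex : ∃ w ∈ S, ¬ ∃ W' ⊆ S.filter (fun x => G.Adj w x), GoodSet G M d W' := by
        by_contra hcon
        push Not at hcon
        apply hno
        refine ⟨S, subset_rfl, hMS', fun w hw => ?_⟩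
        obtain ⟨W', h1, h2⟩ := hcon w hw
        exact ⟨W', h1.trans (Finset.filter_subset _ _),
          fun x hx => (Finset.mem_filter.1 (h1 hx)).2, h2⟩
      obtain ⟨w, hw, hnw⟩ := hex
      by_cases hcase : (S.card : ℝ) * (1 / g) ≤ (S.filter (fun x => G.Adj w x)).card
      · obtain ⟨T, hT, h2, h3⟩ := ihd (S.filter (fun x => G.Adj w x)) (by
          refine hS.trans ?_
          rw [pow_succ (1 / g : ℝ) d]
          calc (S.card : ℝ) * ((1 / g : ℝ) ^ d * (1 / g) * (1 - 2 / g : ℝ) ^ (t + 1))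
              = (S.card * (1 / g)) * ((1 / g : ℝ) ^ d * (1 - 2 / g : ℝ) ^ (t + 1)) := by ring
            _ ≤ _ := mul_le_mul_of_nonneg_right hcase (by positivity)) hnw
        exact ⟨T, hT.trans (Finset.filter_subset _ _), h2, h3⟩
      · push Not at hcase
        set S2 := (S.filter (fun x => ¬ G.Adj w x)).erase w with hS2
        have hsub : S2 ⊆ S := (Finset.erase_subset _ _).trans (Finset.filter_subset _ _)
        have hcard : (S2.card : ℝ) + 1 + (S.filter (fun x => G.Adj w x)).card = S.card := by
          have h1 : S2.card + 1 = (S.filter (fun x => ¬ G.Adj w x)).card :=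
            Finset.card_erase_add_one (by simp [hw])
          have h2 := Finset.card_filter_add_card_filter_not (s := S) (fun x => G.Adj w x)
          have : S2.card + 1 + (S.filter (fun x => G.Adj w x)).card = S.card := by omega
          exact_mod_cast this
        have hone : (1 : ℝ) ≤ S.card * (1 / g) := by
          have : (g : ℝ) ≤ S.card := by exact_mod_cast hgM.trans hMS'
          rw [mul_one_div, le_div_iff₀ (by linarith)]; linarith
        have hlow : (S.card : ℝ) * (1 - 2 / g) ≤ S2.card := by
          have : (S.card : ℝ) * (1 - 2 / g) = S.card - S.card * (1 / g) - S.card * (1 / g) := by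
            ring
          linarith
        obtain ⟨T, hT, h2, h3⟩ := iht (d + 1) S2 (by
          refine hS.trans ?_
          rw [pow_succ (1 - 2 / g : ℝ) t]
          calc (S.card : ℝ) * ((1 / g : ℝ) ^ (d + 1) * ((1 - 2 / g : ℝ) ^ t * (1 - 2 / g)))
              = (S.card * (1 - 2 / g)) * ((1 / g : ℝ) ^ (d + 1) * (1 - 2 / g : ℝ) ^ t) := by ring
            _ ≤ _ := mul_le_mul_of_nonneg_right hlow (by positivity))
          (fun ⟨W, hW, hW'⟩ => hno ⟨W, hW.trans hsub, hW'⟩)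
        have hwT : w ∉ T := fun h => by simpa [hS2] using hT h
        refine ⟨insert w T, ?_, ?_, ?_⟩
        · exact Finset.insert_subset hw (hT.trans hsub)
        · rw [Finset.card_insert_of_notMem hwT, h2]
        · rw [Finset.coe_insert, SimpleGraph.isClique_insert]
          refine ⟨h3, fun b hb hne => ?_⟩
          have hb' := hT hb
          simp only [hS2, Finset.mem_erase, Finset.mem_filter] at hb'
          rw [SimpleGraph.compl_adj]
          exact ⟨hne, hb'.2.2⟩

/-- Fix `c > 0`. There is `ε > 0` such that for every sufficiently large
`n` and every `c`-Ramsey graph `G` on `n` vertices, every treelike resolution refutation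
of the unary formula `Ψ'_G` has length at least `n^(ε·log₂ n)`. -/
theorem psiUnary_treelike_lower_bound (c : ℝ) (hc : 0 < c) :
    ∃ ε : ℝ, 0 < ε ∧ ∃ N : ℕ, ∀ n : ℕ, N ≤ n →
      ∀ G : SimpleGraph (Fin n), IsCRamsey c G →
        ∀ t : ResTree (PsiUnary c G) (∅ : Clause (UnaryVar c n)),
          (n : ℝ) ^ (ε * Real.logb 2 n) ≤ (t.size : ℝ) := by
  obtain ⟨a, ha⟩ := pow_unbounded_of_one_lt (16 * (c + 1)) (one_lt_two : (1 : ℝ) < 2)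
  have ha1 : 1 ≤ a := by
    rcases a with _ | a
    · norm_num at ha; linarith
    · omega
  have haR : (1 : ℝ) ≤ a := by exact_mod_cast ha1
  refine ⟨1 / (32 * a), by positivity, 2 ^ (16 + 4 * a), ?_⟩
  intro n hn G hG tr
  set k : ℝ := Real.logb 2 n with hk
  have hn0 : (0 : ℝ) < n := by
    have : 0 < n := lt_of_lt_of_le (by positivity) hn
    exact_mod_cast this
  have hnk : (2 : ℝ) ^ k = n := Real.rpow_logb (by norm_num) (by norm_num) hn0
  have hkK : (16 : ℝ) + 4 * a ≤ k := by
    rw [hk, Real.le_logb_iff_rpow_le (by norm_num) hn0]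
    have : (2 : ℝ) ^ (16 + 4 * a) ≤ n := by exact_mod_cast hn
    refine le_trans (le_of_eq ?_) this
    rw [← Real.rpow_natCast]
    push_cast
    rfl
  have hk0 : 0 < k := by linarith
  set g : ℕ := 2 ^ a with hg
  have hgR : (g : ℝ) = 2 ^ a := by simp [hg]
  set d : ℕ := ⌊k / (4 * a)⌋₊ with hd
  set M : ℕ := ⌊(2 : ℝ) ^ (k / 2)⌋₊ with hM
  have hg2 : 2 ≤ g := by
    calc 2 = 2 ^ 1 := rfl
      _ ≤ 2 ^ a := Nat.pow_le_pow_right (by norm_num) ha1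
  have hgM : g ≤ M := by
    apply Nat.le_floor
    rw [hgR, ← Real.rpow_natCast]
    exact Real.rpow_le_rpow_of_exponent_le (by norm_num) (by linarith)
  have hdu : (d : ℝ) ≤ k / (4 * a) := Nat.floor_le (by positivity)
  have hdu' : (d : ℝ) * a ≤ k / 4 := by
    rw [le_div_iff₀ (by positivity)] at hdu
    linarith
  have hdk : (d : ℝ) ≤ k / 4 := by
    have : (d : ℝ) * 1 ≤ d * a := mul_le_mul_of_nonneg_left haR (by positivity)
    linarith
  have hdl : k / (8 * a) ≤ d := by
    have h1 : k / (4 * a) < d + 1 := Nat.lt_floor_add_one _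
    have h2 : (1 : ℝ) ≤ k / (4 * a) := by
      rw [le_div_iff₀ (by positivity)]; linarith
    have h3 : (1 : ℝ) ≤ d := by
      have : 1 ≤ d := Nat.le_floor (by simpa using h2)
      exact_mod_cast this
    have h4 : k / (8 * a) = k / (4 * a) / 2 := by rw [div_div]; ring_nf
    rw [h4]; linarith
  have hgood : ∃ W ⊆ (Finset.univ : Finset (Fin n)), GoodSet G M d W := by
    by_contra hno
    obtain ⟨T, -, hT1, hT2⟩ := indep_of_not_good G M g hg2 hgM ⌈c * k⌉₊ d Finset.univ (by
      have h1 : (2 : ℝ) ^ (-(k / 4)) ≤ (1 / g : ℝ) ^ d := by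
        have : (1 / g : ℝ) ^ d = (2 : ℝ) ^ (-((d : ℝ) * a)) := by
          rw [hgR, Real.rpow_neg (by norm_num), one_div, inv_pow, ← pow_mul, mul_comm a d,
            ← Real.rpow_natCast]
          push_cast
          rfl
        rw [this]
        exact Real.rpow_le_rpow_of_exponent_le (by norm_num) (by linarith)
      have hgpos : (0 : ℝ) < g := by rw [hgR]; positivity
      have hg16 : 16 * (c + 1) ≤ (g : ℝ) := by rw [hgR]; exact ha.le
      have h2 : (2 : ℝ) ^ (-(k / 4)) ≤ (1 - 2 / g : ℝ) ^ ⌈c * k⌉₊ := by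
        have hb : (2 : ℝ) ^ (-(4 / g : ℝ)) ≤ 1 - 2 / g := by
          have := rpow_one_add_le_one_add_mul_self (s := (-(1 / 2) : ℝ)) (by norm_num)
            (p := (4 / g : ℝ)) (by positivity) (by rw [div_le_one hgpos]; linarith)
          have e1 : (1 + -(1 / 2) : ℝ) = 2⁻¹ := by norm_num
          rw [e1, Real.inv_rpow (by norm_num), ← Real.rpow_neg (by norm_num)] at this
          refine this.trans (le_of_eq ?_)
          ring
        refine le_trans ?_ (pow_le_pow_left₀ (by positivity) hb _)
        rw [← Real.rpow_natCast, ← Real.rpow_mul (by norm_num)]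
        apply Real.rpow_le_rpow_of_exponent_le (by norm_num)
        have ht : (⌈c * k⌉₊ : ℝ) ≤ (c + 1) * k := by
          have := (Nat.ceil_lt_add_one (show 0 ≤ c * k by positivity)).le
          linarith
        have : 4 / (g : ℝ) * ⌈c * k⌉₊ ≤ k / 4 := by
          rw [div_mul_eq_mul_div, div_le_iff₀ hgpos]
          have := mul_le_mul_of_nonneg_right hg16 hk0.le
          linarith
        linarith
      have h3 : (M : ℝ) ≤ (2 : ℝ) ^ (k / 2) := Nat.floor_le (by positivity)
      rw [Finset.card_univ, Fintype.card_fin]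
      refine h3.trans ?_
      calc (2 : ℝ) ^ (k / 2) = n * ((2 : ℝ) ^ (-(k / 4)) * (2 : ℝ) ^ (-(k / 4))) := by
            rw [← hnk, ← Real.rpow_add (by norm_num), ← Real.rpow_add (by norm_num)]
            ring_nf
        _ ≤ _ := by gcongr) hno
    exact hG ⟨T, hT1, Or.inr hT2⟩
  obtain ⟨W, -, hW⟩ := hgood
  have hsize := tree_bound G M tr d M ∅ ∅ W hW (by simp)
    ⟨by simp, by simp, by simp, by simp, by simp, by simp⟩
  have hsizeR : ((d + M).choose d : ℝ) ≤ tr.size := by exact_mod_cast hsize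
  refine le_trans ?_ hsizeR
  refine le_trans ?_ (Nat.pow_le_choose (α := ℝ) d (d + M))
  have hM1 : (2 : ℝ) ^ (k / 2) ≤ ((d + M + 1 - d : ℕ) : ℝ) := by
    rw [show d + M + 1 - d = M + 1 by omega]
    push_cast
    exact (Nat.lt_floor_add_one _).le
  have hfac : (d.factorial : ℝ) ≤ ((2 : ℝ) ^ (k / 4)) ^ d := by
    have h1 : (d.factorial : ℝ) ≤ (d : ℝ) ^ d := by exact_mod_cast Nat.factorial_le_pow d
    refine h1.trans (pow_le_pow_left₀ (by positivity) ?_ _)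
    have h2 : (d : ℝ) ≤ 2 ^ d := by exact_mod_cast Nat.lt_two_pow_self.le
    rw [← Real.rpow_natCast] at h2
    exact h2.trans (Real.rpow_le_rpow_of_exponent_le (by norm_num) hdk)
  rw [le_div_iff₀ (by positivity)]
  refine le_trans ?_ (pow_le_pow_left₀ (by positivity) hM1 _)
  refine le_trans (mul_le_mul_of_nonneg_left hfac (by positivity)) ?_
  have h5 : (n : ℝ) ^ (1 / (32 * a) * k) ≤ ((2 : ℝ) ^ (k / 4)) ^ d := by
    rw [← hnk, ← Real.rpow_natCast, ← Real.rpow_mul (by norm_num), ← Real.rpow_mul (by norm_num)]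
    apply Real.rpow_le_rpow_of_exponent_le (by norm_num)
    have h6 : k * (1 / (32 * a) * k) = k / 4 * (k / (8 * a)) := by
      field_simp
      ring
    rw [h6]
    exact mul_le_mul_of_nonneg_left hdl (by positivity)
  refine le_trans (mul_le_mul_of_nonneg_right h5 (by positivity)) (le_of_eq ?_)
  rw [← mul_pow, ← Real.rpow_add (by norm_num)]
  ring_nf
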